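/- The presented group on three generators x₁, x₂, x₃ with relators x₁^2, x₁*u*x₂*u⁻¹ where u = x₂*x₁, and x₂*v*x₃*v⁻¹ where v = x₃⁻¹*x₂⁻¹, is isomorphic to the Coxeter group W(3,3,∞), i.e. to the presented group on generators x₁, x₂, x₃ with relators x₁^2, x₂^2, x₃^2, (x₁*x₂)^3, (x₂*x₃)^3. (This is the fundamental group computation for τ_{R(D₂(10₉₉))} in Remark 4.21(1).) -/

import Mathlib

/-- The generator `x₁` of the free group on three generators. -/
def x1 : FreeGroup (Fin 3) := FreeGroup.of 0

/-- The generator `x₂` of the free group on three generators. -/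
def x2 : FreeGroup (Fin 3) := FreeGroup.of 1

/-- The generator `x₃` of the free group on three generators. -/
def x3 : FreeGroup (Fin 3) := FreeGroup.of 2

/-- The relators of the Coxeter group `W(3,3,∞)`:
`x₁², x₂², x₃², (x₁x₂)³, (x₂x₃)³`. -/
def W33InfRels : Set (FreeGroup (Fin 3)) :=
  {x1 ^ 2, x2 ^ 2, x3 ^ 2, (x1 * x2) ^ 3, (x2 * x3) ^ 3}

/-- The word `u = x₂x₁`. -/
def u : FreeGroup (Fin 3) := x2 * x1

/-- The word `v = x₃⁻¹x₂⁻¹`. -/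
def v : FreeGroup (Fin 3) := x3⁻¹ * x2⁻¹

/-- The τ-presentation relators of `π₁(τ_{R(D₂(10₉₉))})`. -/
def rels17 : Set (FreeGroup (Fin 3)) :=
  {x1 ^ 2, x1 * u * x2 * u⁻¹, x2 * v * x3 * v⁻¹}

/-- An element that is conjugate to the inverse of an involution is an involution. -/
theorem sq_eq_one_of_mul_conj_eq_one {G : Type*} [Group G] {a b w : G} (ha : a ^ 2 = 1)
    (h : a * w * b * w⁻¹ = 1) : b ^ 2 = 1 := by
  have hb : b = w⁻¹ * a⁻¹ * w := by
    rw [mul_inv_eq_one] at h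
    calc b = w⁻¹ * a⁻¹ * (a * w * b) := by group
      _ = w⁻¹ * a⁻¹ * w := by rw [h]
  calc b ^ 2 = w⁻¹ * (a ^ 2)⁻¹ * w := by rw [hb, sq, sq]; group
    _ = 1 := by rw [ha]; group

/-- For involutions `a`, `b`, the relation `a = w b⁻¹ w⁻¹` with `w = ba` is the braid relation. -/
theorem mul_conj_eq_one_iff_mul_pow_three {G : Type*} [Group G] {a b : G} (ha : a ^ 2 = 1)
    (hb : b ^ 2 = 1) : a * (b * a) * b * (b * a)⁻¹ = 1 ↔ (a * b) ^ 3 = 1 := by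
  have ha' : a⁻¹ = a := inv_eq_of_mul_eq_one_right (by rw [← sq, ha])
  have hb' : b⁻¹ = b := inv_eq_of_mul_eq_one_right (by rw [← sq, hb])
  simp only [mul_inv_rev, ha', hb', pow_succ, pow_zero, one_mul, mul_assoc]

/-- The relations of `rels17` and of `W33InfRels` are equivalent in every group. -/
theorem twist_relations_iff_coxeter_relations {G : Type*} [Group G] (a b c : G) :
    (a ^ 2 = 1 ∧ a * (b * a) * b * (b * a)⁻¹ = 1 ∧
      b * (c⁻¹ * b⁻¹) * c * (c⁻¹ * b⁻¹)⁻¹ = 1) ↔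
    (a ^ 2 = 1 ∧ b ^ 2 = 1 ∧ c ^ 2 = 1 ∧ (a * b) ^ 3 = 1 ∧ (b * c) ^ 3 = 1) := by
  have key (hb : b ^ 2 = 1) (hc : c ^ 2 = 1) :
      b * (c⁻¹ * b⁻¹) * c * (c⁻¹ * b⁻¹)⁻¹ = 1 ↔ (b * c) ^ 3 = 1 := by
    have hb' : b⁻¹ = b := inv_eq_of_mul_eq_one_right (by rw [← sq, hb])
    have hc' : c⁻¹ = c := inv_eq_of_mul_eq_one_right (by rw [← sq, hc])
    rw [← mul_conj_eq_one_iff_mul_pow_three hb hc, hb', hc']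
  constructor
  · rintro ⟨ha, hab, hbc⟩
    have hb := sq_eq_one_of_mul_conj_eq_one ha hab
    have hc := sq_eq_one_of_mul_conj_eq_one hb hbc
    exact ⟨ha, hb, hc, (mul_conj_eq_one_iff_mul_pow_three ha hb).1 hab, (key hb hc).1 hbc⟩
  · rintro ⟨ha, hb, hc, hab, hbc⟩
    exact ⟨ha, (mul_conj_eq_one_iff_mul_pow_three ha hb).2 hab, (key hb hc).2 hbc⟩

/-- A normal subgroup of the free group contains the relators `rels17` if and only if it
contains the relators `W33InfRels`. -/
theorem rels17_subset_iff (N : Subgroup (FreeGroup (Fin 3))) [N.Normal] :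
    rels17 ⊆ (N : Set (FreeGroup (Fin 3))) ↔ W33InfRels ⊆ (N : Set (FreeGroup (Fin 3))) := by
  simpa only [rels17, W33InfRels, u, v, Set.insert_subset_iff, Set.singleton_subset_iff,
    SetLike.mem_coe, ← QuotientGroup.eq_one_iff, QuotientGroup.mk_mul, QuotientGroup.mk_inv,
    QuotientGroup.mk_pow] using
    twist_relations_iff_coxeter_relations (x1 : FreeGroup (Fin 3) ⧸ N) x2 x3

theorem normalClosure_rels17_eq :
    Subgroup.normalClosure rels17 = Subgroup.normalClosure W33InfRels :=
  le_antisymm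
    (Subgroup.normalClosure_le_normal ((rels17_subset_iff _).2 Subgroup.subset_normalClosure))
    (Subgroup.normalClosure_le_normal ((rels17_subset_iff _).1 Subgroup.subset_normalClosure))

/-- The fundamental group of the Price twist `τ_{R(D₂(10₉₉))}` is isomorphic to the
Coxeter group `W(3,3,∞)`. -/
theorem stmt_17 : Nonempty (PresentedGroup rels17 ≃* PresentedGroup W33InfRels) := by
  exact ⟨QuotientGroup.quotientMulEquivOfEq normalClosure_rels17_eq⟩
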